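/- For every positive integer n there exists ε > 0 such that for every real σ with |σ − n| < ε and every irrational x ∈ (0,1), one has B_σ(x) ≥ B_σ(η_{n+1}); that is, the global minimum of the σ-Brjuno function is attained at the fixed point η_{n+1} = (√((n+1)²+4) − (n+1))/2 for all σ in an open interval containing n. -/

import Mathlib

open Real Set MeasureTheory
open scoped ENNReal

/-- The Gauss map `A(x) = 1/x - ⌊1/x⌋`. -/
noncomputable def gaussMap (x : ℝ) : ℝ := 1 / x - (⌊1 / x⌋ : ℝ)

/-- `brjunoBeta x j = β_{j-1}(x) = ∏_{i=0}^{j-1} A^i(x)`; in particular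
`brjunoBeta x 0 = β_{-1}(x) = 1` and `β_K(x) = brjunoBeta x (K+1)`. -/
noncomputable def brjunoBeta (x : ℝ) (j : ℕ) : ℝ := ∏ i ∈ Finset.range j, gaussMap^[i] x

/-- The σ-Brjuno function `B_σ(x) = Σ_{j≥0} β_{j-1}(x) · (A^j x)^{-1/σ}`, valued in `[0,+∞]`. -/
noncomputable def brjuno (σ x : ℝ) : ℝ≥0∞ :=
  ∑' j : ℕ, ENNReal.ofReal (brjunoBeta x j * (gaussMap^[j] x) ^ (-(1 / σ)))

/-- The K-th partial sum `B_σ^{(K)}(x) = Σ_{j=0}^{K} β_{j-1}(x) · (A^j x)^{-1/σ}`. -/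
noncomputable def brjunoPartial (σ x : ℝ) (K : ℕ) : ℝ :=
  ∑ j ∈ Finset.range (K + 1), brjunoBeta x j * (gaussMap^[j] x) ^ (-(1 / σ))

/-- The fixed point `η_m = (√(m²+4) − m)/2 = [0; m, m, m, ...]` of the Gauss map. -/
noncomputable def eta (m : ℕ) : ℝ := (Real.sqrt ((m : ℝ) ^ 2 + 4) - m) / 2

/-- `b* = (σ+1)^{1+1/σ}/σ`. -/
noncomputable def bstar (σ : ℝ) : ℝ := (σ + 1) ^ (1 + 1 / σ) / σ

/-- The global lower bound `g(x) = x^{-1/σ} + b*·x`. -/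
noncomputable def gLow (σ x : ℝ) : ℝ := x ^ (-(1 / σ)) + bstar σ * x

/-- The cylinder lower bound `g_k(x) = x^{-1/σ} + x·(1/x − k)^{-1/σ} + (1 − kx)·b*`. -/
noncomputable def gCyl (σ : ℝ) (k : ℕ) (x : ℝ) : ℝ :=
  x ^ (-(1 / σ)) + x * (1 / x - (k : ℝ)) ^ (-(1 / σ)) + (1 - (k : ℝ) * x) * bstar σ

/-- The graph of `w ↦ w ^ (1 + s)` lies above its tangent lines. -/
lemma rpow_one_add_tangent_le {s a w : ℝ} (hs : 0 ≤ s) (ha : 0 < a) (hw : 0 < w) :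
    a ^ (1 + s) + (1 + s) * a ^ s * (w - a) ≤ w ^ (1 + s) := by
  have h := one_add_mul_self_le_rpow_one_add (s := w / a - 1) (p := 1 + s)
    (by have := div_pos hw ha; linarith) (by linarith)
  rw [add_sub_cancel, Real.div_rpow hw.le ha.le, le_div_iff₀ (by positivity)] at h
  refine le_trans (le_of_eq ?_) h
  rw [Real.rpow_add ha, Real.rpow_one]
  field_simp

/-- The graph of `w ↦ w ^ (-s)` lies above its tangent lines. -/
lemma rpow_neg_tangent_le {s a w : ℝ} (hs : 0 ≤ s) (ha : 0 < a) (hw : 0 < w) :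
    a ^ (-s) - s * a ^ (-s) / a * (w - a) ≤ w ^ (-s) := by
  have hq : 0 < w / a := div_pos hw ha
  have h1 : 1 - s * (w / a - 1) ≤ (w / a) ^ (-s) := by
    rw [Real.rpow_def_of_pos hq]
    have h2 := Real.add_one_le_exp (Real.log (w / a) * -s)
    have h3 := mul_le_mul_of_nonneg_left (Real.log_le_sub_one_of_pos hq) hs
    linarith
  rw [Real.div_rpow hw.le ha.le, le_div_iff₀ (by positivity)] at h1
  refine le_trans (le_of_eq ?_) h1
  field_simp

/-- For fixed `t > 0`, the function `a ↦ a (log (a + t) - log (a - t))` is strictly decreasing. -/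
lemma mul_log_add_sub_log_sub_lt {t a b : ℝ} (ht : 0 < t) (hta : t < a) (hab : a < b) :
    b * (Real.log (b + t) - Real.log (b - t)) < a * (Real.log (a + t) - Real.log (a - t)) := by
  have key : ∀ c : ℝ, t < c →
      HasSum (fun k : ℕ => 2 * (1 / (2 * (k : ℝ) + 1)) * t ^ (2 * k + 1) * (1 / c) ^ (2 * k))
        (c * (Real.log (c + t) - Real.log (c - t))) := by
    intro c hc
    have hc0 : 0 < c := ht.trans hc
    have hlt : t / c < 1 := (div_lt_one hc0).2 hc
    have h := (Real.hasSum_log_sub_log_of_abs_lt_one (x := t / c)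
      (by rw [abs_of_pos (div_pos ht hc0)]; exact hlt)).mul_left c
    have h1 : Real.log (1 + t / c) = Real.log (c + t) - Real.log c := by
      rw [← Real.log_div (by positivity) hc0.ne']
      congr 1
      field_simp
    have h2 : Real.log (1 - t / c) = Real.log (c - t) - Real.log c := by
      rw [← Real.log_div (by linarith) hc0.ne']
      congr 1
      field_simp
    rw [h1, h2, sub_sub_sub_cancel_right] at h
    refine h.congr_fun ?_
    intro k
    rw [div_pow, div_pow, pow_succ c, one_pow]
    field_simp
  have ha0 : 0 < a := ht.trans hta
  have hle : 1 / b < 1 / a := one_div_lt_one_div_of_lt ha0 hab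
  have hb : 0 ≤ 1 / b := by have := ha0.trans hab; positivity
  refine hasSum_lt (i := 1) (fun k => ?_) ?_ (key b (hta.trans hab)) (key a hta)
  · gcongr
  · have : (1 / b) ^ (2 * 1) < (1 / a) ^ (2 * 1) := pow_lt_pow_left₀ hle hb (by norm_num)
    exact mul_lt_mul_of_pos_left this (by positivity)

lemma gaussMap_eq_fract (x : ℝ) : gaussMap x = Int.fract (1 / x) := rfl

lemma brjunoBeta_succ (x : ℝ) (j : ℕ) :
    brjunoBeta x (j + 1) = x * brjunoBeta (gaussMap x) j := by
  simp [brjunoBeta, Finset.prod_range_succ', mul_comm]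

/-- The functional equation `B_σ(x) = x^{-1/σ} + x B_σ(A x)`. -/
lemma brjuno_eq (σ : ℝ) {x : ℝ} (hx : 0 ≤ x) :
    brjuno σ x
      = ENNReal.ofReal (x ^ (-(1 / σ))) + ENNReal.ofReal x * brjuno σ (gaussMap x) := by
  unfold brjuno
  rw [tsum_eq_zero_add' ENNReal.summable, ← ENNReal.tsum_mul_left]
  congr 1
  · simp [brjunoBeta]
  · refine tsum_congr fun j => ?_
    rw [brjunoBeta_succ, Function.iterate_succ_apply, mul_assoc, ENNReal.ofReal_mul hx]

/-- At a fixed point of the Gauss map the Brjuno function is a geometric series. -/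
lemma brjuno_of_fixed (σ : ℝ) {x : ℝ} (hx0 : 0 ≤ x) (hx1 : x < 1) (hx : gaussMap x = x) :
    brjuno σ x = ENNReal.ofReal (x ^ (-(1 / σ)) / (1 - x)) := by
  have hit : ∀ i : ℕ, gaussMap^[i] x = x := fun i => Function.iterate_fixed hx i
  have hsum : HasSum (fun j : ℕ => x ^ j * x ^ (-(1 / σ))) ((1 - x)⁻¹ * x ^ (-(1 / σ))) :=
    (hasSum_geometric_of_lt_one hx0 hx1).mul_right _
  simp only [brjuno, brjunoBeta, hit, Finset.prod_const, Finset.card_range]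
  rw [← ENNReal.ofReal_tsum_of_nonneg (fun j => by positivity) hsum.summable, hsum.tsum_eq,
    div_eq_inv_mul (x ^ (-(1 / σ)))]

/-- Decomposition of an irrational `x ∈ (0,1)` as `1 / (k + A x)`. -/
lemma exists_inv_eq_add_gaussMap {x : ℝ} (hx : Irrational x) (hx01 : x ∈ Set.Ioo (0 : ℝ) 1) :
    Irrational (gaussMap x) ∧ gaussMap x ∈ Set.Ioo (0 : ℝ) 1 ∧
      ∃ k : ℕ, 1 ≤ k ∧ x * (k + gaussMap x) = 1 := by
  obtain ⟨h0, h1⟩ := hx01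
  have hirr : Irrational (gaussMap x) := by
    unfold gaussMap
    rw [one_div]
    exact hx.inv.sub_intCast _
  have hone : (1 : ℝ) ≤ 1 / x := by rw [le_div_iff₀ h0]; linarith
  have hnonneg : 0 ≤ gaussMap x := Int.fract_nonneg _
  refine ⟨hirr, ⟨lt_of_le_of_ne hnonneg (hirr.ne_zero).symm, Int.fract_lt_one _⟩,
    ⌊1 / x⌋₊, Nat.le_floor (by simpa using hone), ?_⟩
  rw [gaussMap, natCast_floor_eq_intCast_floor (by positivity)]
  field_simp
  ring

/-- A lower bound `L` for `B_σ` improves to `M - c (M - L)`, with `c = 1 - 1 / (2 M)`. -/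
lemma brjuno_lower_bound_improve {σ M L : ℝ} (hσ : 0 < σ) (hM : 1 ≤ M) (hL0 : 0 ≤ L) (hLM : L ≤ M)
    (H : ∀ k : ℕ, 1 ≤ k → ∀ y ∈ Set.Ioo (0 : ℝ) 1,
      M * (k + y - 1) ≤ (k + y) ^ (1 + 1 / σ) ∨
        k * M ≤ (k + y) ^ (1 + 1 / σ) + y ^ (-(1 / σ)))
    (hL : ∀ x : ℝ, Irrational x → x ∈ Set.Ioo (0 : ℝ) 1 → ENNReal.ofReal L ≤ brjuno σ x)
    {x : ℝ} (hx : Irrational x) (hx01 : x ∈ Set.Ioo (0 : ℝ) 1) :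
    ENNReal.ofReal (M - (1 - 1 / (2 * M)) * (M - L)) ≤ brjuno σ x := by
  obtain ⟨hyirr, hy01, k, hk, hxy⟩ := exists_inv_eq_add_gaussMap hx hx01
  rw [brjuno_eq σ hx01.1.le]
  set y := gaussMap x
  obtain ⟨hx0, hx1⟩ := hx01
  set s := 1 / σ
  have hs : 0 < s := one_div_pos.2 hσ
  have hk' : (1 : ℝ) ≤ k := by exact_mod_cast hk
  have hw : 0 < k + y := by linarith [hy01.1]
  have hxw : x = (k + y)⁻¹ := eq_inv_of_mul_eq_one_left hxy
  have hpow : x * (k + y) ^ (1 + s) = x ^ (-s) := by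
    rw [hxw, Real.inv_rpow hw.le, Real.rpow_neg hw.le, inv_inv, Real.rpow_add hw, Real.rpow_one]
    field_simp
  have hMc : M * (1 / (2 * M)) = 1 / 2 := by field_simp
  have hinv : 1 / (2 * M) ≤ 1 / 2 := by
    rw [div_le_div_iff₀ (by linarith) (by norm_num)]; linarith
  have hinv0 : 0 < 1 / (2 * M) := by positivity
  generalize 1 / (2 * M) = κ at hMc hinv hinv0 ⊢
  rcases H k hk y hy01 with h | h
  · have hone : M * (1 - x) ≤ x ^ (-s) := by
      have := mul_le_mul_of_nonneg_left h hx0.le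
      rw [hpow] at this
      linear_combination this - M * hxy
    have hreal : M - (1 - κ) * (M - L) ≤ x ^ (-s) + x * L := by
      by_cases hc : x ≤ 1 - κ
      · nlinarith [mul_nonneg (sub_nonneg.2 hc) (sub_nonneg.2 hLM)]
      · have h1 : 1 ≤ x ^ (-s) :=
          Real.one_le_rpow_of_pos_of_le_one_of_nonpos hx0 hx1.le (by linarith)
        push Not at hc
        nlinarith [mul_nonneg (sub_nonneg.2 hc.le) hL0]
    calc ENNReal.ofReal (M - (1 - κ) * (M - L)) ≤ ENNReal.ofReal (x ^ (-s) + x * L) :=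
          ENNReal.ofReal_le_ofReal hreal
      _ = ENNReal.ofReal (x ^ (-s)) + ENNReal.ofReal x * ENNReal.ofReal L := by
          rw [ENNReal.ofReal_add (by positivity) (by positivity), ENNReal.ofReal_mul hx0.le]
      _ ≤ _ := by gcongr; exact hL y hyirr hy01
  · obtain ⟨_, hz01, -⟩ := exists_inv_eq_add_gaussMap hyirr hy01
    have hzirr := (exists_inv_eq_add_gaussMap hyirr hy01).1
    rw [brjuno_eq σ hy01.1.le]
    set z := gaussMap y
    obtain ⟨hy0, hy1⟩ := hy01
    have htwo : M * (1 - x * y) ≤ x ^ (-s) + x * y ^ (-s) := by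
      have := mul_le_mul_of_nonneg_left h hx0.le
      rw [mul_add, hpow] at this
      linear_combination this - M * hxy
    have hprod : x * y ≤ 1 / 2 := by nlinarith
    have hreal : M - (1 - κ) * (M - L) ≤ x ^ (-s) + x * (y ^ (-s) + y * L) := by
      nlinarith [mul_nonneg (sub_nonneg.2 (show x * y ≤ 1 - κ by linarith)) (sub_nonneg.2 hLM)]
    calc ENNReal.ofReal (M - (1 - κ) * (M - L))
          ≤ ENNReal.ofReal (x ^ (-s) + x * (y ^ (-s) + y * L)) := ENNReal.ofReal_le_ofReal hreal
      _ = ENNReal.ofReal (x ^ (-s)) + ENNReal.ofReal x *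
            (ENNReal.ofReal (y ^ (-s)) + ENNReal.ofReal y * ENNReal.ofReal L) := by
          rw [ENNReal.ofReal_add (by positivity) (by positivity), ENNReal.ofReal_mul hx0.le,
            ENNReal.ofReal_add (by positivity) (by positivity), ENNReal.ofReal_mul hy0.le]
      _ ≤ _ := by gcongr; exact hL z hzirr hz01

/-- A sufficient condition, on each branch of the Gauss map, for `M` to bound `B_σ` from below. -/
lemma le_brjuno_of_branch {σ M : ℝ} (hσ : 0 < σ) (hM : 1 ≤ M)
    (H : ∀ k : ℕ, 1 ≤ k → ∀ y ∈ Set.Ioo (0 : ℝ) 1,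
      M * (k + y - 1) ≤ (k + y) ^ (1 + 1 / σ) ∨
        k * M ≤ (k + y) ^ (1 + 1 / σ) + y ^ (-(1 / σ)))
    {x : ℝ} (hx : Irrational x) (hx01 : x ∈ Set.Ioo (0 : ℝ) 1) :
    ENNReal.ofReal M ≤ brjuno σ x := by
  set c := 1 - 1 / (2 * M) with hc
  have hc1 : c < 1 := by have : 0 < 1 / (2 * M) := by positivity
                         linarith
  have hc0 : 0 ≤ c := by
    have : 1 / (2 * M) ≤ 1 := by rw [div_le_one (by linarith)]; linarith
    linarith
  have hN : ∀ N : ℕ, ∀ x : ℝ, Irrational x → x ∈ Set.Ioo (0 : ℝ) 1 →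
      ENNReal.ofReal (M - c ^ N * M) ≤ brjuno σ x := by
    intro N
    induction N with
    | zero => intro x _ _; simp
    | succ N ih =>
      intro x hx hx01
      have hcN0 : 0 ≤ c ^ N := pow_nonneg hc0 N
      have hcN1 : c ^ N ≤ 1 := pow_le_one₀ hc0 hc1.le
      have h := brjuno_lower_bound_improve hσ hM (L := M - c ^ N * M) (by nlinarith)
        (by nlinarith) H ih hx hx01
      convert h using 2
      rw [← hc]
      ring
  have ht : Filter.Tendsto (fun N : ℕ => ENNReal.ofReal (M - c ^ N * M)) Filter.atTop
      (nhds (ENNReal.ofReal M)) := by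
    refine ENNReal.tendsto_ofReal ?_
    simpa using ((tendsto_pow_atTop_nhds_zero_of_lt_one hc0 hc1).mul_const M).const_sub M
  exact le_of_tendsto' ht fun N => hN N x hx hx01

lemma eta_pos (m : ℕ) : 0 < eta m := by
  have : (m : ℝ) < Real.sqrt ((m : ℝ) ^ 2 + 4) := Real.lt_sqrt_of_sq_lt (by linarith)
  unfold eta
  linarith

lemma eta_mul_add_eta (m : ℕ) : eta m * (m + eta m) = 1 := by
  have := Real.sq_sqrt (show (0 : ℝ) ≤ (m : ℝ) ^ 2 + 4 by positivity)
  unfold eta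
  linear_combination this / 4

lemma eta_lt_one {m : ℕ} (hm : 1 ≤ m) : eta m < 1 := by
  have h0 := eta_pos m
  have h1 := eta_mul_add_eta m
  have : (1 : ℝ) ≤ m := by exact_mod_cast hm
  nlinarith

lemma gaussMap_eta {m : ℕ} (hm : 1 ≤ m) : gaussMap (eta m) = eta m := by
  have h : 1 / eta m = (m : ℤ) + eta m := by
    rw [div_eq_iff (eta_pos m).ne', Int.cast_natCast]
    linear_combination -(eta_mul_add_eta m)
  rw [gaussMap_eq_fract, h, Int.fract_intCast_add, Int.fract_eq_self]
  exact ⟨(eta_pos m).le, eta_lt_one hm⟩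

/-- The branches `k ≥ n + 1`: here `w = n + 1 + η` with `η w = 1`. -/
lemma branch_of_gt {n k : ℕ} {s η w M y : ℝ} (hs : 0 < s) (hη : 0 < η) (hw : w = n + 1 + η)
    (hηw : η * w = 1) (hM : M * (w - 1) = w ^ (1 + s)) (hA : 1 + s ≤ s * w)
    (hk : n + 1 ≤ k) (hy : 0 < y) :
    M * (k + y - 1) ≤ (k + y) ^ (1 + s) ∨ k * M ≤ (k + y) ^ (1 + s) + y ^ (-s) := by
  have hw1 : 1 < w := by rw [hw]; have : (0 : ℝ) ≤ n := by positivity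
                         linarith
  have hw0 : 0 < w := by linarith
  have hpow : w ^ (1 + s) = w * w ^ s := by rw [Real.rpow_add hw0, Real.rpow_one]
  have hws : 0 < w ^ s := by positivity
  have hk' : (n : ℝ) + 1 ≤ k := by exact_mod_cast hk
  have hslope : M ≤ (1 + s) * w ^ s := by
    refine le_of_mul_le_mul_right ?_ (sub_pos.2 hw1)
    rw [hM, hpow]
    nlinarith
  rcases le_or_gt w (k + y) with h | h
  · left
    have ht := rpow_one_add_tangent_le hs.le hw0 (hw0.trans_le h)
    nlinarith [mul_nonneg (sub_nonneg.2 hslope) (sub_nonneg.2 h)]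
  · right
    have hkn : k = n + 1 := by
      have hη1 : η < 1 := by nlinarith
      have : (k : ℝ) < n + 2 := by linarith
      have : k < n + 2 := by exact_mod_cast this
      omega
    have hkr : (k : ℝ) = w - η := by rw [hkn, hw]; push_cast; ring
    have hyη : y < η := by linarith
    have ht := rpow_one_add_tangent_le (w := k + y) hs.le hw0 (by linarith)
    have ht' := rpow_neg_tangent_le hs.le hη hy
    have hηi : η = w⁻¹ := eq_inv_of_mul_eq_one_left hηw
    have hηs : η ^ (-s) = w ^ s := by
      rw [hηi, Real.inv_rpow hw0.le, Real.rpow_neg hw0.le, inv_inv]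
    have hdiv : s * w ^ s / η = s * w ^ s * w := by rw [hηi, div_inv_eq_mul]
    rw [hηs, hdiv] at ht'
    have hkM : k * M = w ^ (1 + s) + w ^ s := by
      have h1 : w ≠ 0 := hw0.ne'
      have h2 : w * k = (w - 1) * (w + 1) := by rw [hkr]; linear_combination -hηw
      apply mul_left_cancel₀ h1
      have : w * (k * M) = (w + 1) * (M * (w - 1)) := by linear_combination M * h2
      rw [this, hM, hpow]
      ring
    have e : (k : ℝ) + y - w = y - η := by rw [hkr]; ring
    rw [e] at ht
    have := mul_nonneg (mul_nonneg hws.le (sub_nonneg.2 hA)) (sub_nonneg.2 hyη.le)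
    nlinarith

/-- The branches `k ≤ n`, provided the weak branch condition holds at `v = n + 1 - η`. -/
lemma branch_of_le {n k : ℕ} {s η v w M y : ℝ} (hs : 0 < s) (hη : 0 < η) (hn : 2 ≤ n)
    (hη1 : η < 1) (hw : w = n + 1 + η) (hv : v = n + 1 - η) (hM : M * (w - 1) = w ^ (1 + s))
    (hB : M * (v - 1) ≤ v ^ (1 + s)) (hC : n * M ≤ v ^ (1 + s) + 1)
    (hk1 : 1 ≤ k) (hk : k ≤ n) (hy : 0 < y) (hy1 : y < 1) :
    M * (k + y - 1) ≤ (k + y) ^ (1 + s) ∨ k * M ≤ (k + y) ^ (1 + s) + y ^ (-s) := by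
  have hn' : (2 : ℝ) ≤ n := by exact_mod_cast hn
  have hk1' : (1 : ℝ) ≤ k := by exact_mod_cast hk1
  have hv0 : 0 < v := by linarith
  have hw0 : 0 < w := by linarith
  rcases le_or_gt (k + y) v with h | h
  · left
    have t1 := rpow_one_add_tangent_le (w := k + y) hs.le hv0 (by linarith)
    have t2 := rpow_one_add_tangent_le hs.le hv0 hw0
    have hslope : (1 + s) * v ^ s ≤ M := by
      by_contra! hcon
      have : 0 < w - v := by linarith
      nlinarith [mul_pos (sub_pos.2 hcon) this]
    nlinarith [mul_nonneg (sub_nonneg.2 hslope) (sub_nonneg.2 h)]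
  · right
    have hkn : k = n := by
      by_contra hne
      have : k + 1 ≤ n := by omega
      have : (k : ℝ) + 1 ≤ n := by exact_mod_cast this
      linarith
    subst hkn
    have h1 : v ^ (1 + s) ≤ (k + y) ^ (1 + s) := by gcongr
    have h2 : 1 ≤ y ^ (-s) :=
      Real.one_le_rpow_of_pos_of_le_one_of_nonpos hy hy1.le (by linarith)
    linarith

/-- At `σ = n ≥ 2` both conditions of `branch_of_le` are strict. -/
lemma branch_conditions_strict {n : ℕ} {η v w M : ℝ} (hn : 2 ≤ n) (hη : 0 < η) (hη1 : η < 1)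
    (hw : w = n + 1 + η) (hv : v = n + 1 - η) (hηw : η * w = 1)
    (hM : M * (w - 1) = w ^ (1 + 1 / (n : ℝ))) :
    M * (v - 1) < v ^ (1 + 1 / (n : ℝ)) ∧ n * M < v ^ (1 + 1 / (n : ℝ)) + 1 := by
  have hn' : (2 : ℝ) ≤ n := by exact_mod_cast hn
  have hn0 : (0 : ℝ) < n := by linarith
  have hv0 : 0 < v := by linarith
  have hw0 : 0 < w := by linarith
  have hM0 : 0 < M := by
    have : 0 < M * (w - 1) := by rw [hM]; positivity
    exact pos_of_mul_pos_left this (by linarith)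
  have hB : M * (v - 1) < v ^ (1 + 1 / (n : ℝ)) := by
    rw [← Real.log_lt_log_iff (mul_pos hM0 (by linarith)) (by positivity),
      Real.log_mul hM0.ne' (by linarith), Real.log_rpow hv0]
    have hlogM := congrArg Real.log hM
    rw [Real.log_mul hM0.ne' (by linarith), Real.log_rpow hw0] at hlogM
    have h := mul_log_add_sub_log_sub_lt hη (show η < (n : ℝ) by linarith) (lt_add_one (n : ℝ))
    rw [← hw, ← hv, show (n : ℝ) + η = w - 1 by linarith,
      show (n : ℝ) - η = v - 1 by linarith] at h
    have h3 : (1 + 1 / (n : ℝ)) * (Real.log w - Real.log v)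
        < Real.log (w - 1) - Real.log (v - 1) := by
      refine lt_of_mul_lt_mul_left ?_ hn0.le
      refine lt_of_eq_of_lt ?_ h
      field_simp
    linarith
  refine ⟨hB, ?_⟩
  have hroot : w ^ (1 / (n : ℝ)) ≤ w - 1 := by
    calc w ^ (1 / (n : ℝ)) ≤ w ^ (1 / (2 : ℝ)) := by
          apply Real.rpow_le_rpow_of_exponent_le (by linarith)
          exact one_div_le_one_div_of_le (by norm_num) hn'
      _ = Real.sqrt w := (Real.sqrt_eq_rpow w).symm
      _ ≤ w - 1 := by
          rw [Real.sqrt_le_left (by linarith)]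
          nlinarith
  have hηM : η * M ≤ 1 := by
    refine le_of_mul_le_mul_right ?_ (show 0 < w - 1 by linarith)
    rw [mul_assoc, hM, Real.rpow_add hw0, Real.rpow_one, ← mul_assoc, hηw]
    linarith
  have : (n : ℝ) * M = M * (v - 1) + η * M := by rw [hv]; ring
  linarith

/-- Near `s = 1` the branch `k = 1` of the case `n = 1` is controlled by the tangent lines at
`y = 4/7`. -/
lemma branch_one {s M y : ℝ} (hs : 0 < s) (hy : 0 < y) (hy1 : y < 1)
    (h0 : M ≤ (11 / 7 : ℝ) ^ (1 + s) + (4 / 7 : ℝ) ^ (-s)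
      + ((1 + s) * (11 / 7 : ℝ) ^ s - s * (4 / 7 : ℝ) ^ (-s) / (4 / 7)) * (0 - 4 / 7))
    (h1 : M ≤ (11 / 7 : ℝ) ^ (1 + s) + (4 / 7 : ℝ) ^ (-s)
      + ((1 + s) * (11 / 7 : ℝ) ^ s - s * (4 / 7 : ℝ) ^ (-s) / (4 / 7)) * (1 - 4 / 7)) :
    M ≤ (1 + y) ^ (1 + s) + y ^ (-s) := by
  have t1 := rpow_one_add_tangent_le (a := 11 / 7) (w := 1 + y) hs.le (by norm_num) (by linarith)
  have t2 := rpow_neg_tangent_le (a := 4 / 7) (w := y) hs.le (by norm_num) hy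
  have g0 := mul_le_mul_of_nonneg_left h0 (sub_nonneg.2 hy1.le)
  have g1 := mul_le_mul_of_nonneg_left h1 hy.le
  nlinarith

/-- All branch conditions hold for `s` close to `1 / n`. -/
lemma eventually_branch {n : ℕ} (hn : 0 < n) {η w : ℝ} (hη : 0 < η) (hη1 : η < 1)
    (hw : w = n + 1 + η) (hηw : η * w = 1) :
    ∀ᶠ s : ℝ in nhds (1 / (n : ℝ)), ∀ k : ℕ, 1 ≤ k → ∀ y ∈ Set.Ioo (0 : ℝ) 1,
      w ^ (1 + s) / (w - 1) * (k + y - 1) ≤ (k + y) ^ (1 + s) ∨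
        k * (w ^ (1 + s) / (w - 1)) ≤ (k + y) ^ (1 + s) + y ^ (-s) := by
  have hn0 : (0 : ℝ) < n := by exact_mod_cast hn
  have hw1 : 1 < w := by linarith
  have hw0 : 0 < w := by linarith
  have hMeq : ∀ s : ℝ, w ^ (1 + s) / (w - 1) * (w - 1) = w ^ (1 + s) := fun s =>
    div_mul_cancel₀ _ (by linarith)
  have hcont : ∀ a : ℝ, 0 < a → Continuous fun s : ℝ => a ^ s := fun a ha =>
    Real.continuous_const_rpow ha.ne'
  have hcw : Continuous fun s : ℝ => w ^ (1 + s) / (w - 1) :=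
    ((hcont w hw0).comp (by fun_prop : Continuous fun s : ℝ => 1 + s)).div_const _
  have hpos : ∀ᶠ s : ℝ in nhds (1 / (n : ℝ)), 0 < s := lt_mem_nhds (by positivity)
  have hA : ∀ᶠ s : ℝ in nhds (1 / (n : ℝ)), 1 + s < s * w := by
    refine ContinuousAt.eventually_lt (by fun_prop) (by fun_prop) ?_
    rw [hw]
    field_simp
    linarith
  rcases Nat.lt_or_ge n 2 with h2 | h2
  · obtain rfl : n = 1 := by omega
    have hη2 : η < 1 / 2 := by push_cast at hw; nlinarith
    have hMval : w ^ (1 + (1 / ((1 : ℕ) : ℝ))) / (w - 1) < 4.15 := by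
      have : (1 : ℝ) + 1 / ((1 : ℕ) : ℝ) = (2 : ℕ) := by norm_num
      rw [this, Real.rpow_natCast, div_lt_iff₀ (by linarith)]
      push_cast at hw
      have hηl : 0.41 < η := by nlinarith
      nlinarith
    have c1 : Continuous fun s : ℝ => (11 / 7 : ℝ) ^ (1 + s) :=
      (hcont _ (by norm_num)).comp (by fun_prop : Continuous fun s : ℝ => 1 + s)
    have c2 : Continuous fun s : ℝ => (11 / 7 : ℝ) ^ s := hcont _ (by norm_num)
    have c3 : Continuous fun s : ℝ => (4 / 7 : ℝ) ^ (-s) :=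
      (hcont _ (by norm_num)).comp (by fun_prop : Continuous fun s : ℝ => -s)
    have e2 : (1 : ℝ) + 1 = (2 : ℕ) := by norm_num
    have hend : ∀ t : ℝ, 0 ≤ t → ∀ᶠ s : ℝ in nhds (1 / ((1 : ℕ) : ℝ)), w ^ (1 + s) / (w - 1) <
        (11 / 7 : ℝ) ^ (1 + s) + (4 / 7 : ℝ) ^ (-s)
          + ((1 + s) * (11 / 7 : ℝ) ^ s - s * (4 / 7 : ℝ) ^ (-s) / (4 / 7)) * (t - 4 / 7) := by
      intro t ht
      refine ContinuousAt.eventually_lt hcw.continuousAt (by fun_prop) (hMval.trans ?_)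
      rw [Nat.cast_one, div_one, e2, Real.rpow_natCast, Real.rpow_neg_one, Real.rpow_one]
      norm_num
      linarith
    filter_upwards [hpos, hA, hend 0 le_rfl, hend 1 zero_le_one] with s hs hAs h0 h1 k hk y hy
    rcases Nat.lt_or_ge k 2 with hk2 | hk2
    · obtain rfl : k = 1 := by omega
      right
      have := branch_one hs hy.1 hy.2 h0.le h1.le
      simpa using this
    · exact branch_of_gt hs hη hw hηw (hMeq s) hAs.le hk2 hy.1
  · obtain ⟨hB, hC⟩ := branch_conditions_strict h2 hη hη1 hw rfl hηw (hMeq _)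
    have hn' : (2 : ℝ) ≤ n := by exact_mod_cast h2
    have hcv : Continuous fun s : ℝ => ((n : ℝ) + 1 - η) ^ (1 + s) :=
      (hcont _ (by linarith)).comp (by fun_prop : Continuous fun s : ℝ => 1 + s)
    have hB' := ContinuousAt.eventually_lt
      (f := fun s : ℝ => w ^ (1 + s) / (w - 1) * ((n : ℝ) + 1 - η - 1))
      (by fun_prop) hcv.continuousAt hB
    have hC' := ContinuousAt.eventually_lt (f := fun s : ℝ => (n : ℝ) * (w ^ (1 + s) / (w - 1)))
      (g := fun s : ℝ => ((n : ℝ) + 1 - η) ^ (1 + s) + 1) (by fun_prop)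
      (hcv.add_const 1).continuousAt hC
    filter_upwards [hpos, hA, hB', hC'] with s hs hAs hBs hCs k hk y hy
    rcases Nat.lt_or_ge n k with hkn | hkn
    · exact branch_of_gt hs hη hw hηw (hMeq s) hAs.le hkn hy.1
    · exact branch_of_le hs hη h2 hη1 hw rfl (hMeq s) hBs.le hCs.le hk hkn hy.1 hy.2

/-- stability of the minimizer: for every `n ∈ ℕ` there is a
neighbourhood of `n` in which the global minimum of `B_σ` is attained at `η_{n+1}`. -/
theorem brjuno_minimizer_stable (n : ℕ) (hn : 0 < n) :
    ∃ ε : ℝ, 0 < ε ∧ ∀ σ : ℝ, |σ - (n : ℝ)| < ε →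
      ∀ x : ℝ, Irrational x → x ∈ Set.Ioo (0 : ℝ) 1 →
        brjuno σ (eta (n + 1)) ≤ brjuno σ x := by
  have hn0 : (0 : ℝ) < n := by exact_mod_cast hn
  have hη := eta_pos (n + 1)
  have hη1 := eta_lt_one (m := n + 1) (by omega)
  have hfix := gaussMap_eta (m := n + 1) (by omega)
  have hηw := eta_mul_add_eta (n + 1)
  set η := eta (n + 1)
  push_cast at hηw
  have hev := eventually_branch hn hη hη1 rfl hηw
  have hinv : Filter.Tendsto (fun σ : ℝ => 1 / σ) (nhds (n : ℝ)) (nhds (1 / (n : ℝ))) :=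
    (continuousAt_const.div continuousAt_id hn0.ne').tendsto
  obtain ⟨ε, hε, hball⟩ :=
    Metric.eventually_nhds_iff.1 ((hinv.eventually hev).and (lt_mem_nhds hn0))
  refine ⟨ε, hε, fun σ hσ x hx hx01 => ?_⟩
  obtain ⟨hbr, hσ0⟩ := hball (by rwa [Real.dist_eq])
  set w := (n : ℝ) + 1 + η with hw
  have hw1 : 1 < w := by linarith
  have hw0 : 0 < w := by linarith
  have hs : 0 < 1 / σ := one_div_pos.2 hσ0
  have hM1 : 1 ≤ w ^ (1 + 1 / σ) / (w - 1) := by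
    rw [le_div_iff₀ (by linarith)]
    have := Real.rpow_le_rpow_of_exponent_le hw1.le (show 1 ≤ 1 + 1 / σ by linarith)
    rw [Real.rpow_one] at this
    linarith
  have hval : η ^ (-(1 / σ)) / (1 - η) = w ^ (1 + 1 / σ) / (w - 1) := by
    have hηi : η = w⁻¹ := eq_inv_of_mul_eq_one_left hηw
    have hpow : η ^ (-(1 / σ)) = w ^ (1 / σ) := by
      rw [hηi, Real.inv_rpow hw0.le, Real.rpow_neg hw0.le, inv_inv]
    rw [hpow, Real.rpow_add hw0, Real.rpow_one, div_eq_div_iff (by linarith) (by linarith)]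
    linear_combination w ^ (1 / σ) * hηw
  rw [brjuno_of_fixed σ hη.le hη1 hfix, hval]
  exact le_brjuno_of_branch hσ0 hM1 hbr hx hx01
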